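/- Let R be a commutative coherent ring and M a GP-pure flat R-module of finite Gorenstein flat dimension. Then M is Gorenstein flat. -/

import Mathlib

open CategoryTheory Opposite Limits MonoidalCategory

universe u

variable {R : Type u} [CommRing R]

/-- `Q` is a Gorenstein projective module: it is the cokernel `Coker (P₁ → P₀)` of a totally
acyclic complex of projective modules, i.e. an exact complex of projectives which stays exact
under `Hom(-, P)` for every projective `P`. -/
def IsGorensteinProjective (Q : ModuleCat.{u} R) : Prop :=
  ∃ C : ChainComplex (ModuleCat.{u} R) ℤ,
    (∀ i, Projective (C.X i)) ∧
    (∀ i, C.ExactAt i) ∧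
    Nonempty (Q ≅ cokernel (C.d 1 0)) ∧
    ∀ P : ModuleCat.{u} R, Projective P →
      ∀ (i : ℤ) (f : C.X i ⟶ P), C.d (i + 1) i ≫ f = 0 →
        ∃ g : C.X (i - 1) ⟶ P, f = C.d i (i - 1) ≫ g

/-- `E` is a Gorenstein injective module: it is the kernel `Ker (I⁰ → I¹)` of a totally acyclic
complex of injective modules, i.e. an exact complex of injectives which stays exact under
`Hom(I, -)` for every injective `I`. -/
def IsGorensteinInjective (E : ModuleCat.{u} R) : Prop :=
  ∃ C : CochainComplex (ModuleCat.{u} R) ℤ,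
    (∀ i, Injective (C.X i)) ∧
    (∀ i, C.ExactAt i) ∧
    Nonempty (E ≅ kernel (C.d 0 1)) ∧
    ∀ I : ModuleCat.{u} R, Injective I →
      ∀ (i : ℤ) (f : I ⟶ C.X i), f ≫ C.d i (i + 1) = 0 →
        ∃ g : I ⟶ C.X (i - 1), f = g ≫ C.d (i - 1) i

/-- `M` is a Gorenstein flat module: it is a cokernel in an exact complex of flat modules which
remains exact after tensoring with any injective module. -/
def IsGorensteinFlat (M : ModuleCat.{u} R) : Prop :=
  ∃ C : ChainComplex (ModuleCat.{u} R) ℤ,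
    (∀ i, Module.Flat R (C.X i)) ∧
    (∀ i, C.ExactAt i) ∧
    Nonempty (M ≅ cokernel (C.d 1 0)) ∧
    ∀ I : ModuleCat.{u} R, Injective I → ∀ i : ℤ,
      (((tensorLeft I).mapHomologicalComplex (ComplexShape.down ℤ)).obj C).ExactAt i

/-- A short exact sequence `0 → X₁ → X₂ → X₃ → 0` is `𝒳`-pure exact if
`Hom(U, X₂) → Hom(U, X₃)` is surjective for every `U ∈ 𝒳`. -/
def XPureExact (𝒳 : ModuleCat.{u} R → Prop) (S : ShortComplex (ModuleCat.{u} R)) : Prop :=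
  ∀ U : ModuleCat.{u} R, 𝒳 U → ∀ φ : U ⟶ S.X₃, ∃ ψ : U ⟶ S.X₂, ψ ≫ S.g = φ

/-- A short exact sequence `0 → X₁ → X₂ → X₃ → 0` is `𝒳`-copure exact if
`Hom(X₂, V) → Hom(X₁, V)` is surjective for every `V ∈ 𝒳`. -/
def XCopureExact (𝒳 : ModuleCat.{u} R → Prop) (S : ShortComplex (ModuleCat.{u} R)) : Prop :=
  ∀ V : ModuleCat.{u} R, 𝒳 V → ∀ φ : S.X₁ ⟶ V, ∃ ψ : S.X₂ ⟶ V, S.f ≫ ψ = φ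

/-- `M` is `𝒳`-pure flat: `M ⊗ -` leaves every `𝒳`-pure exact short exact sequence exact. -/
def XPureFlat (𝒳 : ModuleCat.{u} R → Prop) (M : ModuleCat.{u} R) : Prop :=
  ∀ S : ShortComplex (ModuleCat.{u} R), S.ShortExact → XPureExact 𝒳 S →
    Function.Injective ((tensorLeft M).map S.f)

/-- `N` is `𝒳`-pure injective: `Hom(-, N)` leaves every `𝒳`-pure exact short exact
sequence exact. -/
def XPureInjective (𝒳 : ModuleCat.{u} R → Prop) (N : ModuleCat.{u} R) : Prop :=
  ∀ S : ShortComplex (ModuleCat.{u} R), S.ShortExact → XPureExact 𝒳 S →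
    ∀ φ : S.X₁ ⟶ N, ∃ ψ : S.X₂ ⟶ N, S.f ≫ ψ = φ

/-- `M` is `𝒳`-pure projective: `Hom(M, -)` leaves every `𝒳`-pure exact short exact
sequence exact. -/
def XPureProjective (𝒳 : ModuleCat.{u} R → Prop) (M : ModuleCat.{u} R) : Prop :=
  ∀ S : ShortComplex (ModuleCat.{u} R), S.ShortExact → XPureExact 𝒳 S →
    ∀ φ : M ⟶ S.X₃, ∃ ψ : M ⟶ S.X₂, ψ ≫ S.g = φ

/-- `GP`-pure exactness: `Hom(Q, -)` leaves the sequence exact for all Gorenstein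
projective `Q`. -/
abbrev GPPureExact (S : ShortComplex (ModuleCat.{u} R)) : Prop :=
  XPureExact IsGorensteinProjective S

/-- `GI`-copure exactness: `Hom(-, E)` leaves the sequence exact for all Gorenstein
injective `E`. -/
abbrev GICopureExact (S : ShortComplex (ModuleCat.{u} R)) : Prop :=
  XCopureExact IsGorensteinInjective S

abbrev GPPureProjective (M : ModuleCat.{u} R) : Prop :=
  XPureProjective IsGorensteinProjective M

abbrev GPPureInjective (M : ModuleCat.{u} R) : Prop :=
  XPureInjective IsGorensteinProjective M

abbrev GPPureFlat (M : ModuleCat.{u} R) : Prop :=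
  XPureFlat IsGorensteinProjective M

/-- `Ext^n_R(M, N)` vanishes. -/
abbrev extVanish (n : ℕ) (M N : ModuleCat.{u} R) : Prop :=
  Subsingleton (((Ext R (ModuleCat.{u} R) n).obj (op M)).obj N)

/-- `M` belongs to `GP^⊥`. -/
abbrev MemGPperp (M : ModuleCat.{u} R) : Prop :=
  ∀ Q : ModuleCat.{u} R, IsGorensteinProjective Q → extVanish 1 Q M

/-- `M` belongs to `^⊥GI`. -/
abbrev MemPerpGI (M : ModuleCat.{u} R) : Prop :=
  ∀ E : ModuleCat.{u} R, IsGorensteinInjective E → extVanish 1 M E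

/-- Gorenstein projective dimension of `M` is at most `n`: there is a resolution
`0 → G_n → ⋯ → G_0 → M → 0` by Gorenstein projective modules. -/
def GpdLE : ℕ → ModuleCat.{u} R → Prop
  | 0, M => IsGorensteinProjective M
  | n + 1, M =>
    ∃ S : ShortComplex (ModuleCat.{u} R), S.ShortExact ∧ Nonempty (S.X₃ ≅ M) ∧
      IsGorensteinProjective S.X₂ ∧ GpdLE n S.X₁

/-- Gorenstein injective dimension of `M` is at most `n`: there is a coresolution
`0 → M → E⁰ → ⋯ → Eⁿ → 0` by Gorenstein injective modules. -/
def GidLE : ℕ → ModuleCat.{u} R → Prop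
  | 0, M => IsGorensteinInjective M
  | n + 1, M =>
    ∃ S : ShortComplex (ModuleCat.{u} R), S.ShortExact ∧ Nonempty (S.X₁ ≅ M) ∧
      IsGorensteinInjective S.X₂ ∧ GidLE n S.X₃

/-- Gorenstein flat dimension of `M` is at most `n`. -/
def GfdLE : ℕ → ModuleCat.{u} R → Prop
  | 0, M => IsGorensteinFlat M
  | n + 1, M =>
    ∃ S : ShortComplex (ModuleCat.{u} R), S.ShortExact ∧ Nonempty (S.X₃ ≅ M) ∧
      IsGorensteinFlat S.X₂ ∧ GfdLE n S.X₁

/-- The Pontryagin dual `M⁺ = Hom_ℤ(M, ℚ/ℤ)` as an `R`-module. -/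
noncomputable def characterDual (M : ModuleCat.{u} R) : ModuleCat.{u} R :=
  ModuleCat.of R (CharacterModule M)

/-- `R` is a coherent ring: every finitely generated ideal is finitely presented. -/
def IsCoherentRing (R : Type u) [CommRing R] : Prop :=
  ∀ I : Ideal R, I.FG → Module.FinitePresentation R I

/-- `φ : G → M` is a Gorenstein projective precover. -/
def IsGPPrecover {G M : ModuleCat.{u} R} (φ : G ⟶ M) : Prop :=
  IsGorensteinProjective G ∧
    ∀ G' : ModuleCat.{u} R, IsGorensteinProjective G' →
      ∀ ψ : G' ⟶ M, ∃ χ : G' ⟶ G, χ ≫ φ = ψ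

/-- The short exact sequence `0 → Im d_{i+1} → X_i → Im d_i → 0` extracted from a complex. -/
noncomputable def imagesShortComplex (C : ChainComplex (ModuleCat.{u} R) ℤ) (i : ℤ) :
    ShortComplex (ModuleCat.{u} R) :=
  ShortComplex.mk (image.ι (C.d (i + 1) i)) (factorThruImage (C.d i (i - 1)))
    (by
      rw [← cancel_epi (factorThruImage (C.d (i + 1) i)),
        ← cancel_mono (image.ι (C.d i (i - 1)))]
      simp)

/-- `f` and `g` form a short exact sequence `0 → A → B → C → 0`. -/
structure IsSES {A B C : Type u} [AddCommGroup A] [AddCommGroup B] [AddCommGroup C]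
    [Module R A] [Module R B] [Module R C] (f : A →ₗ[R] B) (g : B →ₗ[R] C) : Prop where
  inj : Function.Injective f
  exact : Function.Exact f g
  surj : Function.Surjective g

/-- `Ext^n_R(A, B)` vanishes. -/
abbrev ExtZero (R : Type u) [CommRing R] (A B : Type u) [AddCommGroup A] [AddCommGroup B]
    [Module R A] [Module R B] (n : ℕ) : Prop :=
  Subsingleton (Abelian.Ext (ModuleCat.of R A) (ModuleCat.of R B) n)

/-- `Ext^n_R(I, M⁺)` vanishes for all injective `I` and all `n ≥ 1`; equivalently,
`Tor_n^R(I, M)` vanishes. -/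
def TorZero (R : Type u) [CommRing R] (M : Type u) [AddCommGroup M] [Module R M] : Prop :=
  ∀ (I : Type u) [AddCommGroup I] [Module R I], Module.Injective R I →
    ∀ n, ExtZero R I (CharacterModule M) (n + 1)

/-- `M` has an infinite coresolution by flat modules, all of whose cosyzygies are acyclic for
tensoring with injective modules. -/
def FlatCoresolvable (R : Type u) [CommRing R] (M : Type u) [AddCommGroup M] [Module R M] : Prop :=
  ∃ W : ModuleCat.{u} R → Prop, W (ModuleCat.of R M) ∧ ∀ X, W X → TorZero R X ∧
    ∃ (F X' : ModuleCat.{u} R) (f : X →ₗ[R] F) (g : F →ₗ[R] X'),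
      IsSES f g ∧ Module.Flat R F ∧ W X'

section Basics

variable {A B C D X Y Z : Type u} [AddCommGroup A] [AddCommGroup B] [AddCommGroup C]
  [AddCommGroup D] [AddCommGroup X] [AddCommGroup Y] [AddCommGroup Z]
  [Module R A] [Module R B] [Module R C] [Module R D] [Module R X] [Module R Y] [Module R Z]

namespace IsSES

theorem comp_eq_zero {f : A →ₗ[R] B} {g : B →ₗ[R] C} (h : IsSES f g) : g ∘ₗ f = 0 :=
  h.exact.linearMap_comp_eq_zero

theorem shortExact {f : A →ₗ[R] B} {g : B →ₗ[R] C} (h : IsSES f g) :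
    (ModuleCat.shortComplexOfCompEqZero f g h.comp_eq_zero).ShortExact :=
  ModuleCat.shortComplex_shortExact _ h.exact h.inj h.surj

theorem of_shortExact {S : ShortComplex (ModuleCat.{u} R)} (hS : S.ShortExact) :
    IsSES S.f.hom S.g.hom :=
  ⟨hS.moduleCat_injective_f,
    (ShortComplex.ShortExact.moduleCat_exact_iff_function_exact S).1 hS.exact,
    hS.moduleCat_surjective_g⟩

/-- A map out of the middle term killing the first one descends to the last term. -/
theorem desc {f : A →ₗ[R] B} {g : B →ₗ[R] C} (h : IsSES f g) (k : B →ₗ[R] Z)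
    (hk : k ∘ₗ f = 0) : ∃ l : C →ₗ[R] Z, l ∘ₗ g = k := by
  have hle : LinearMap.ker g ≤ LinearMap.ker k := by
    intro b hb
    obtain ⟨a, rfl⟩ := (h.exact b).1 hb
    exact LinearMap.congr_fun hk a
  refine ⟨(LinearMap.ker g).liftQ k hle ∘ₗ (g.quotKerEquivOfSurjective h.surj).symm, ?_⟩
  ext b
  have : (g.quotKerEquivOfSurjective h.surj).symm (g b) = Submodule.Quotient.mk b := by
    rw [LinearEquiv.symm_apply_eq]; rfl
  simp [this]

theorem mkQ {f : A →ₗ[R] B} (hf : Function.Injective f) :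
    IsSES f (LinearMap.range f).mkQ :=
  ⟨hf, LinearMap.exact_map_mkQ_range f, Submodule.mkQ_surjective _⟩

theorem ker_subtype {g : B →ₗ[R] C} (hg : Function.Surjective g) :
    IsSES (LinearMap.ker g).subtype g :=
  ⟨Subtype.val_injective, LinearMap.exact_subtype_ker_map g, hg⟩

theorem dual {f : A →ₗ[R] B} {g : B →ₗ[R] C} (h : IsSES f g) :
    IsSES (CharacterModule.dual g) (CharacterModule.dual f) := by
  refine ⟨CharacterModule.dual_injective_of_surjective g h.surj, ?_,
    CharacterModule.dual_surjective_of_injective f h.inj⟩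
  intro c
  constructor
  · intro hc
    have hle : (g.toAddMonoidHom).ker ≤ AddMonoidHom.ker (c : B →+ AddCircle (1 : ℚ)) := by
      intro b hb
      obtain ⟨a, rfl⟩ := (h.exact b).1 hb
      exact DFunLike.congr_fun hc a
    refine ⟨AddMonoidHom.liftOfSurjective g.toAddMonoidHom h.surj ⟨c, hle⟩, ?_⟩
    exact CharacterModule.ext _ fun b =>
      AddMonoidHom.liftOfRightInverse_comp_apply g.toAddMonoidHom _
        (Function.rightInverse_surjInv h.surj) ⟨c, hle⟩ b
  · rintro ⟨d, rfl⟩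
    exact CharacterModule.ext _ fun a =>
      (congrArg d (LinearMap.congr_fun h.comp_eq_zero a)).trans d.map_zero

/-- A retraction of the first map of a short exact sequence gives a section of the second. -/
theorem section_of_retraction {f : A →ₗ[R] B} {g : B →ₗ[R] C} (h : IsSES f g)
    {r : B →ₗ[R] A} (hr : r ∘ₗ f = LinearMap.id) :
    ∃ s : C →ₗ[R] B, g ∘ₗ s = LinearMap.id := by
  obtain ⟨s, hs⟩ := h.desc (LinearMap.id - f ∘ₗ r) (by
    rw [LinearMap.sub_comp, LinearMap.comp_assoc, hr]; simp)
  refine ⟨s, ?_⟩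
  ext c
  obtain ⟨b, rfl⟩ := h.surj c
  have h1 := LinearMap.congr_fun hs b
  have h2 := LinearMap.congr_fun h.comp_eq_zero (r b)
  simp only [LinearMap.comp_apply, LinearMap.zero_apply] at h1 h2
  simp [h1, h2]

/-- A section of the second map of a short exact sequence gives a retraction of the first. -/
theorem retraction_of_section {f : A →ₗ[R] B} {g : B →ₗ[R] C} (h : IsSES f g)
    {s : C →ₗ[R] B} (hs : g ∘ₗ s = LinearMap.id) :
    ∃ r : B →ₗ[R] A, r ∘ₗ f = LinearMap.id := by
  have key : ∀ b, ∃ a, f a = b - s (g b) := fun b =>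
    (h.exact _).1 (by
      have := LinearMap.congr_fun hs (g b)
      simp only [LinearMap.comp_apply, LinearMap.id_apply] at this
      rw [map_sub, this, sub_self])
  choose r hr using key
  refine ⟨⟨⟨r, fun x y => h.inj ?_⟩, fun c x => h.inj ?_⟩, ?_⟩
  · rw [map_add, hr, hr, hr]; simp; abel
  · simp [hr, smul_sub]
  · ext a
    refine h.inj ?_
    have := LinearMap.congr_fun h.comp_eq_zero a
    simp only [LinearMap.comp_apply, LinearMap.zero_apply] at this
    simp [hr, this]

/-- Third isomorphism theorem: if `0 → A → B → A' → 0`, `0 → B → C → D → 0` and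
`0 → A → C → Y → 0` are exact, then so is `0 → A' → Y → D → 0`. -/
theorem third_iso {f : A →ₗ[R] B} {p : B →ₗ[R] X} (h₁ : IsSES f p)
    {v : B →ₗ[R] C} {q : C →ₗ[R] D} (h₂ : IsSES v q) {w : C →ₗ[R] Y} (h₃ : IsSES (v ∘ₗ f) w) :
    ∃ (a : X →ₗ[R] Y) (b : Y →ₗ[R] D), IsSES a b := by
  obtain ⟨a, ha⟩ := h₁.desc (w ∘ₗ v) (by rw [LinearMap.comp_assoc]; exact h₃.comp_eq_zero)
  obtain ⟨b, hb⟩ := h₃.desc q (by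
    rw [← LinearMap.comp_assoc, h₂.comp_eq_zero, LinearMap.zero_comp])
  have ha' : ∀ x, a (p x) = w (v x) := LinearMap.congr_fun ha
  have hbq : ∀ x, b (w x) = q x := LinearMap.congr_fun hb
  refine ⟨a, b, ?_, ?_, ?_⟩
  · rw [injective_iff_map_eq_zero]
    intro x hx
    obtain ⟨y, rfl⟩ := h₁.surj x
    rw [ha'] at hx
    obtain ⟨z, hz⟩ := (h₃.exact _).1 hx
    rw [← h₂.inj hz]
    exact LinearMap.congr_fun h₁.comp_eq_zero z
  · intro y
    obtain ⟨c, rfl⟩ := h₃.surj y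
    rw [hbq]
    constructor
    · intro hc
      obtain ⟨z, rfl⟩ := (h₂.exact _).1 hc
      exact ⟨p z, ha' z⟩
    · rintro ⟨x, hx⟩
      obtain ⟨z, rfl⟩ := h₁.surj x
      rw [ha'] at hx
      rw [← hbq, ← hx, hbq]
      exact LinearMap.congr_fun h₂.comp_eq_zero z
  · intro d
    obtain ⟨c, rfl⟩ := h₂.surj d
    exact ⟨w c, hbq c⟩

/-- Horseshoe lemma: the middle term of a short exact sequence embeds in the direct sum of
modules in which the outer terms embed, if the first embedding extends to the middle term. -/
theorem horseshoe {A' C' J F : Type u} [AddCommGroup A'] [AddCommGroup C'] [AddCommGroup J]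
    [AddCommGroup F] [Module R A'] [Module R C'] [Module R J] [Module R F]
    {f : A →ₗ[R] B} {g : B →ₗ[R] C} (h : IsSES f g) {u : A →ₗ[R] J} {p : J →ₗ[R] A'}
    (h₁ : IsSES u p) {v : C →ₗ[R] F} {q : F →ₗ[R] C'} (h₂ : IsSES v q)
    {k : B →ₗ[R] J} (hk : k ∘ₗ f = u) {w : J × F →ₗ[R] Y} (hw : IsSES (k.prod (v ∘ₗ g)) w) :
    ∃ (a : A' →ₗ[R] Y) (b : Y →ₗ[R] C'), IsSES a b := by
  have hk' : ∀ x, k (f x) = u x := LinearMap.congr_fun hk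
  have hgf : ∀ x, g (f x) = 0 := LinearMap.congr_fun h.comp_eq_zero
  have hqv : ∀ x, q (v x) = 0 := LinearMap.congr_fun h₂.comp_eq_zero
  have hpu : ∀ x, p (u x) = 0 := LinearMap.congr_fun h₁.comp_eq_zero
  have hw0 : ∀ x, w (k x, v (g x)) = 0 := LinearMap.congr_fun hw.comp_eq_zero
  obtain ⟨a, ha⟩ := h₁.desc (w ∘ₗ LinearMap.inl R J F) (by
    ext x
    have := hw0 (f x)
    rw [hk', hgf, map_zero] at this
    simpa using this)
  obtain ⟨b, hb⟩ := hw.desc (q ∘ₗ LinearMap.snd R J F) (by ext x; simp [hqv])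
  have ha' : ∀ x, a (p x) = w (x, 0) := LinearMap.congr_fun ha
  have hbq : ∀ x, b (w x) = q x.2 := LinearMap.congr_fun hb
  refine ⟨a, b, ?_, ?_, ?_⟩
  · rw [injective_iff_map_eq_zero]
    intro x hx
    obtain ⟨j, rfl⟩ := h₁.surj x
    rw [ha'] at hx
    obtain ⟨y, hy⟩ := (hw.exact _).1 hx
    have hy₁ : k y = j := congrArg Prod.fst hy
    have hy₂ : v (g y) = 0 := congrArg Prod.snd hy
    have : g y = 0 := h₂.inj (by rw [hy₂, map_zero])
    obtain ⟨z, rfl⟩ := (h.exact _).1 this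
    rw [← hy₁, hk', hpu]
  · intro y
    obtain ⟨⟨j, x⟩, rfl⟩ := hw.surj y
    rw [hbq]
    constructor
    · intro hx
      obtain ⟨c, hc⟩ := (h₂.exact _).1 hx
      obtain ⟨y, rfl⟩ := h.surj c
      refine ⟨p (j - k y), ?_⟩
      rw [ha', ← sub_eq_zero, ← map_sub, ← neg_eq_zero, ← map_neg]
      rw [← hw0 y, hc]
      simp
    · rintro ⟨x', hx'⟩
      obtain ⟨j', rfl⟩ := h₁.surj x'
      rw [ha'] at hx'
      rw [← hbq (j, x), ← hx', hbq]
      simp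
  · intro c
    obtain ⟨x, rfl⟩ := h₂.surj c
    exact ⟨w (0, x), hbq _⟩

/-- The pushout of two short exact sequences starting at the same module. -/
theorem pushout {i : A →ₗ[R] B} {p : B →ₗ[R] C} (h₁ : IsSES i p)
    {j : A →ₗ[R] X} {q : X →ₗ[R] Y} (h₂ : IsSES j q) {w : B × X →ₗ[R] Z}
    (hw : IsSES (i.prod (-j)) w) :
    ∃ b : Z →ₗ[R] Y, IsSES (w ∘ₗ LinearMap.inl R B X) b := by
  have hpi : ∀ x, p (i x) = 0 := LinearMap.congr_fun h₁.comp_eq_zero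
  have hqj : ∀ x, q (j x) = 0 := LinearMap.congr_fun h₂.comp_eq_zero
  have hw0 : ∀ x, w (i x, - j x) = 0 := LinearMap.congr_fun hw.comp_eq_zero
  obtain ⟨b, hb⟩ := hw.desc (q ∘ₗ LinearMap.snd R B X) (by ext x; simp [hqj])
  have hbq : ∀ x, b (w x) = q x.2 := LinearMap.congr_fun hb
  refine ⟨b, ?_, ?_, ?_⟩
  · rw [injective_iff_map_eq_zero]
    intro x hx
    obtain ⟨y, hy⟩ := (hw.exact _).1 hx
    have hy₁ : i y = x := congrArg Prod.fst hy
    have hy₂ : -j y = 0 := congrArg Prod.snd hy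
    have : y = 0 := h₂.inj (by rw [neg_eq_zero.1 hy₂, map_zero])
    rw [← hy₁, this, map_zero]
  · intro y
    obtain ⟨⟨x, z⟩, rfl⟩ := hw.surj y
    rw [hbq]
    constructor
    · intro hx
      obtain ⟨c, rfl⟩ := (h₂.exact _).1 hx
      refine ⟨x + i c, ?_⟩
      have : w (x + i c, 0) = w (x, j c) + w (i c, - j c) := by rw [← map_add]; simp
      simp [this, hw0]
    · rintro ⟨x', hx'⟩
      rw [← hbq (x, z), ← hx']
      simp [hbq]
  · intro y
    obtain ⟨x, rfl⟩ := h₂.surj y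
    exact ⟨w (0, x), hbq _⟩

end IsSES

/-- Exchanging the arguments of a bilinear pairing with values in `ℚ/ℤ`. -/
def CharacterModule.swap (φ : A →ₗ[R] CharacterModule B) : B →ₗ[R] CharacterModule A where
  toFun b := (AddMonoidHom.eval (b : B)).comp φ.toAddMonoidHom
  map_add' b b' := CharacterModule.ext _ fun a => map_add (φ a) b b'
  map_smul' r b := CharacterModule.ext _ fun a => by
    change φ a (r • b) = φ (r • a) b
    rw [φ.map_smul]; rfl

theorem lTensor_injective_iff {f : A →ₗ[R] B} :
    Function.Injective (f.lTensor X) ↔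
      ∀ φ : A →ₗ[R] CharacterModule X, ∃ ψ : B →ₗ[R] CharacterModule X, ψ ∘ₗ f = φ := by
  rw [LinearMap.lTensor_inj_iff_rTensor_inj, rTensor_injective_iff_lcomp_surjective]
  rfl

theorem lTensor_injective_of_lift {f : A →ₗ[R] B}
    (h : ∀ φ : X →ₗ[R] CharacterModule A, ∃ ψ : X →ₗ[R] CharacterModule B,
      CharacterModule.dual f ∘ₗ ψ = φ) : Function.Injective (f.lTensor X) := by
  rw [lTensor_injective_iff]
  intro φ
  obtain ⟨ψ, hψ⟩ := h (CharacterModule.swap φ)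
  refine ⟨CharacterModule.swap ψ, ?_⟩
  ext a x
  exact DFunLike.congr_fun (LinearMap.congr_fun hψ x) a

theorem lift_of_lTensor_injective {f : A →ₗ[R] B} (hf : Function.Injective (f.lTensor X))
    (φ : X →ₗ[R] CharacterModule A) : ∃ ψ : X →ₗ[R] CharacterModule B,
      CharacterModule.dual f ∘ₗ ψ = φ := by
  rw [lTensor_injective_iff] at hf
  obtain ⟨ψ, hψ⟩ := hf (CharacterModule.swap φ)
  refine ⟨CharacterModule.swap ψ, ?_⟩
  ext x a
  exact DFunLike.congr_fun (LinearMap.congr_fun hψ a) x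

theorem Module.Injective.of_retract (hB : Module.Injective R B) {s : A →ₗ[R] B} {r : B →ₗ[R] A}
    (h : r ∘ₗ s = LinearMap.id) : Module.Injective R A where
  out P Q _ _ _ _ i hi k := by
    obtain ⟨l, hl⟩ := hB.out i hi (s ∘ₗ k)
    exact ⟨r ∘ₗ l, fun x => by
      rw [LinearMap.comp_apply, hl]; exact LinearMap.congr_fun h (k x)⟩

theorem Module.Flat.dual_injective (hA : Module.Flat R A) :
    Module.Injective R (CharacterModule A) :=
  Module.Flat.iff_characterModule_injective.1 hA

theorem Module.Flat.of_dual_injective (hA : Module.Injective R (CharacterModule A)) :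
    Module.Flat R A :=
  Module.Flat.iff_characterModule_injective.2 hA

theorem Module.Flat.prod' (hA : Module.Flat R A) (hB : Module.Flat R B) :
    Module.Flat R (A × B) := by
  refine Module.Flat.of_dual_injective ⟨fun P Q _ _ _ _ i hi k => ?_⟩
  obtain ⟨a, ha⟩ := hA.dual_injective.out i hi (CharacterModule.dual (LinearMap.inl R A B) ∘ₗ k)
  obtain ⟨b, hb⟩ := hB.dual_injective.out i hi (CharacterModule.dual (LinearMap.inr R A B) ∘ₗ k)
  refine ⟨CharacterModule.dual (LinearMap.fst R A B) ∘ₗ a +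
    CharacterModule.dual (LinearMap.snd R A B) ∘ₗ b, fun x => CharacterModule.ext _ ?_⟩
  rintro ⟨y, z⟩
  change a (i x) y + b (i x) z = k x (y, z)
  rw [ha, hb]
  change k x (y, 0) + k x (0, z) = k x (y, z)
  rw [← map_add]; simp

/-- The canonical map into the double character module. -/
def CharacterModule.ev (R : Type u) [CommRing R] (A : Type u) [AddCommGroup A] [Module R A] :
    A →ₗ[R] CharacterModule (CharacterModule A) :=
  CharacterModule.swap LinearMap.id

theorem CharacterModule.ev_injective : Function.Injective (CharacterModule.ev R A) := by
  rw [injective_iff_map_eq_zero]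
  intro a ha
  exact CharacterModule.eq_zero_of_character_apply fun c => DFunLike.congr_fun ha c

theorem flat_double_dual_quotient (hA : Module.Flat R (CharacterModule (CharacterModule A)))
    {g : CharacterModule (CharacterModule A) →ₗ[R] C} (h : IsSES (CharacterModule.ev R A) g) :
    Module.Flat R C := by
  have hs : CharacterModule.dual (CharacterModule.ev R A) ∘ₗ
      CharacterModule.ev R (CharacterModule A) = LinearMap.id := rfl
  obtain ⟨r, hr⟩ := h.dual.retraction_of_section hs
  exact Module.Flat.of_dual_injective (hA.dual_injective.of_retract hr)

end Basics

section ExtVanishing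

variable {A B C D X Y Z : Type u} [AddCommGroup A] [AddCommGroup B] [AddCommGroup C]
  [AddCommGroup D] [AddCommGroup X] [AddCommGroup Y] [AddCommGroup Z]
  [Module R A] [Module R B] [Module R C] [Module R D] [Module R X] [Module R Y] [Module R Z]

theorem extZero_of_injective (hB : Module.Injective R B) (n : ℕ) : ExtZero R A B (n + 1) := by
  have := (Module.injective_iff_injective_object R B).1 hB
  exact Abelian.Ext.subsingleton_of_injective _ _ _

theorem extZero_of_projective (hA : Module.Projective R A) (n : ℕ) : ExtZero R A B (n + 1) := by
  have := (IsProjective.iff_projective A).1 hA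
  exact Abelian.Ext.subsingleton_of_projective _ _ _

theorem ExtZero.eq_zero {n : ℕ} (h : ExtZero R A B n)
    (x : Abelian.Ext (ModuleCat.of R A) (ModuleCat.of R B) n) : x = 0 :=
  Subsingleton.elim (h := h) _ _

theorem ExtZero.of_eq_zero {n : ℕ}
    (h : ∀ x : Abelian.Ext (ModuleCat.of R A) (ModuleCat.of R B) n, x = 0) : ExtZero R A B n :=
  ⟨fun x y => (h x).trans (h y).symm⟩

theorem ExtZero.of_retract {n : ℕ} (h : ExtZero R X B n) {s : A →ₗ[R] B} {r : B →ₗ[R] A}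
    (hr : r ∘ₗ s = LinearMap.id) : ExtZero R X A n := by
  refine .of_eq_zero fun x => ?_
  have h₁ := h.eq_zero (x.comp (Abelian.Ext.mk₀ (ModuleCat.ofHom s)) (add_zero n))
  have h₂ : ModuleCat.ofHom s ≫ ModuleCat.ofHom r = 𝟙 (ModuleCat.of R A) := by
    rw [← ModuleCat.ofHom_comp, hr]; rfl
  rw [← Abelian.Ext.comp_mk₀_id x, ← h₂, ← Abelian.Ext.mk₀_comp_mk₀,
    ← Abelian.Ext.comp_assoc_of_second_deg_zero, h₁, Abelian.Ext.zero_comp]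

namespace IsSES

theorem extZero_middle {f : A →ₗ[R] B} {g : B →ₗ[R] C} (h : IsSES f g) {n : ℕ}
    (hA : ExtZero R X A n) (hC : ExtZero R X C n) : ExtZero R X B n := by
  refine .of_eq_zero fun x => ?_
  obtain ⟨y, rfl⟩ := Abelian.Ext.covariant_sequence_exact₂ _ h.shortExact x (hC.eq_zero _)
  rw [hA.eq_zero y, Abelian.Ext.zero_comp]

theorem extZero_right {f : A →ₗ[R] B} {g : B →ₗ[R] C} (h : IsSES f g) {n : ℕ}
    (hB : ExtZero R X B n) (hA : ExtZero R X A (n + 1)) : ExtZero R X C n := by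
  refine .of_eq_zero fun x => ?_
  obtain ⟨y, rfl⟩ := Abelian.Ext.covariant_sequence_exact₃ _ h.shortExact x rfl (hA.eq_zero _)
  rw [hB.eq_zero y, Abelian.Ext.zero_comp]

theorem extZero_left {f : A →ₗ[R] B} {g : B →ₗ[R] C} (h : IsSES f g) {n : ℕ}
    (hC : ExtZero R X C n) (hB : ExtZero R X B (n + 1)) : ExtZero R X A (n + 1) := by
  refine .of_eq_zero fun x => ?_
  obtain ⟨y, rfl⟩ := Abelian.Ext.covariant_sequence_exact₁ _ h.shortExact x (hB.eq_zero _) rfl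
  rw [hC.eq_zero y, Abelian.Ext.zero_comp]

theorem extZero_contra_left {f : A →ₗ[R] B} {g : B →ₗ[R] C} (h : IsSES f g) {n : ℕ}
    (hB : ExtZero R B X n) (hC : ExtZero R C X (n + 1)) : ExtZero R A X n := by
  refine .of_eq_zero fun x => ?_
  obtain ⟨y, rfl⟩ := Abelian.Ext.contravariant_sequence_exact₁ h.shortExact _ x (add_comm 1 n)
    (hC.eq_zero _)
  rw [hB.eq_zero y, Abelian.Ext.comp_zero]

theorem lift {f : A →ₗ[R] B} {g : B →ₗ[R] C} (h : IsSES f g)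
    (hA : ExtZero R X A 1) (k : X →ₗ[R] C) : ∃ l : X →ₗ[R] B, g ∘ₗ l = k := by
  obtain ⟨y, hy⟩ := Abelian.Ext.covariant_sequence_exact₃ _ h.shortExact
    (Abelian.Ext.mk₀ (ModuleCat.ofHom k)) rfl (hA.eq_zero _)
  obtain ⟨l, rfl⟩ := (Abelian.Ext.mk₀_bijective _ _).2 y
  rw [Abelian.Ext.mk₀_comp_mk₀] at hy
  exact ⟨l.hom, congrArg ModuleCat.Hom.hom ((Abelian.Ext.mk₀_bijective _ _).1 hy)⟩

theorem extend {f : A →ₗ[R] B} {g : B →ₗ[R] C} (h : IsSES f g)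
    (hC : ExtZero R C X 1) (k : A →ₗ[R] X) : ∃ l : B →ₗ[R] X, l ∘ₗ f = k := by
  obtain ⟨y, hy⟩ := Abelian.Ext.contravariant_sequence_exact₁ h.shortExact _
    (Abelian.Ext.mk₀ (ModuleCat.ofHom k)) rfl (hC.eq_zero _)
  obtain ⟨l, rfl⟩ := (Abelian.Ext.mk₀_bijective _ _).2 y
  rw [Abelian.Ext.mk₀_comp_mk₀] at hy
  exact ⟨l.hom, congrArg ModuleCat.Hom.hom ((Abelian.Ext.mk₀_bijective _ _).1 hy)⟩

theorem extZero_one_of_lift {f : A →ₗ[R] B} {g : B →ₗ[R] C} (h : IsSES f g)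
    (hB : ExtZero R X B 1) (hl : ∀ k : X →ₗ[R] C, ∃ l : X →ₗ[R] B, g ∘ₗ l = k) :
    ExtZero R X A 1 := by
  refine .of_eq_zero fun x => ?_
  obtain ⟨y, rfl⟩ := Abelian.Ext.covariant_sequence_exact₁ _ h.shortExact x (hB.eq_zero _) rfl
  obtain ⟨k, rfl⟩ := (Abelian.Ext.mk₀_bijective _ _).2 y
  obtain ⟨l, hl⟩ := hl k.hom
  have : k = ModuleCat.ofHom l ≫ (ModuleCat.shortComplexOfCompEqZero f g h.comp_eq_zero).g := by
    ext x; exact (LinearMap.congr_fun hl x).symm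
  rw [this, ← Abelian.Ext.mk₀_comp_mk₀, Abelian.Ext.comp_assoc_of_second_deg_zero,
    h.shortExact.comp_extClass, Abelian.Ext.comp_zero]

/-- A map to the dual of an injective module extends along a monomorphism whose cokernel is
acyclic for tensoring with injective modules. -/
theorem extend_dual {f : A →ₗ[R] B} {g : B →ₗ[R] C} (h : IsSES f g) (hC : TorZero R C)
    (hX : Module.Injective R X) (k : A →ₗ[R] CharacterModule X) :
    ∃ l : B →ₗ[R] CharacterModule X, l ∘ₗ f = k := by
  obtain ⟨l, hl⟩ := h.dual.lift (hC X hX 0) (CharacterModule.swap k)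
  refine ⟨CharacterModule.swap l, ?_⟩
  ext a x
  exact DFunLike.congr_fun (LinearMap.congr_fun hl x) a

theorem torZero_middle {f : A →ₗ[R] B} {g : B →ₗ[R] C} (h : IsSES f g)
    (hA : TorZero R A) (hC : TorZero R C) : TorZero R B := fun I _ _ hI n =>
  h.dual.extZero_middle (hC I hI n) (hA I hI n)

theorem torZero_left {f : A →ₗ[R] B} {g : B →ₗ[R] C} (h : IsSES f g)
    (hB : TorZero R B) (hC : TorZero R C) : TorZero R A := fun I _ _ hI n =>
  h.dual.extZero_right (hB I hI n) (hC I hI (n + 1))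

theorem lTensor_injective {f : A →ₗ[R] B} {g : B →ₗ[R] C} (h : IsSES f g)
    (hC : TorZero R C) (hX : Module.Injective R X) : Function.Injective (f.lTensor X) :=
  lTensor_injective_of_lift (h.dual.lift (hC X hX 0))

end IsSES

theorem Module.Flat.torZero (hA : Module.Flat R A) : TorZero R A := fun _ _ _ _ n =>
  extZero_of_injective hA.dual_injective n

end ExtVanishing

theorem CharacterModule.sum_apply {A : Type u} [AddCommGroup A] {ι : Type*} (s : Finset ι)
    (φ : ι → CharacterModule A) (a : A) : (∑ i ∈ s, φ i) a = ∑ i ∈ s, φ i a :=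
  map_sum (AddMonoidHom.eval a : CharacterModule A →+ AddCircle (1 : ℚ)) φ s

/-- Over a coherent ring, the character module of an injective module is flat. -/
theorem flat_dual_of_injective (hcoh : IsCoherentRing R) {E : Type u} [AddCommGroup E] [Module R E]
    (hE : Module.Injective R E) : Module.Flat R (CharacterModule E) := by
  refine Module.Flat.of_forall_isTrivialRelation fun {l f φ} hφ => ?_
  let T : (Fin l → R) →ₗ[R] R := Fintype.linearCombination R f
  have hT : ∀ c, T c = ∑ i, c i * f i := fun c => rfl
  have hSES := IsSES.ker_subtype T.surjective_rangeRestrict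
  have : Module.FinitePresentation R (LinearMap.range T) :=
    hcoh _ (LinearMap.range_eq_map T ▸ Module.Finite.fg_top.map T)
  obtain ⟨m, k, hk⟩ := Submodule.fg_iff_exists_fin_generating_family.1
    (Module.FinitePresentation.fg_ker _ T.surjective_rangeRestrict)
  rw [LinearMap.ker_rangeRestrict] at hk
  have hTk : ∀ j, T (k j) = 0 := fun j => by
    rw [← LinearMap.mem_ker, ← hk]; exact Submodule.subset_span ⟨j, rfl⟩
  let κ : (Fin l → E) →ₗ[R] (Fin m → E) := LinearMap.pi fun j => ∑ i, k j i • LinearMap.proj i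
  have hκ : ∀ v j, κ v j = ∑ i, k j i • v i := fun v j => by simp [κ]
  have hker : ∀ v, κ v = 0 → ∃ e, ∀ i, v i = f i • e := by
    intro v hv
    obtain ⟨s, hs⟩ := hSES.desc (Fintype.linearCombination R v) (by
      rw [LinearMap.ker_rangeRestrict, ← LinearMap.range_le_ker_iff, Submodule.range_subtype, ← hk,
        Submodule.span_le]
      rintro _ ⟨j, rfl⟩
      exact (hκ v j).symm.trans (congrFun hv j))
    obtain ⟨t, ht⟩ := hE.out _ (LinearMap.range T).subtype_injective s
    refine ⟨t 1, fun i => ?_⟩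
    have h₁ := LinearMap.congr_fun hs (Pi.single i 1)
    have h₂ := ht (T.rangeRestrict (Pi.single i 1))
    rw [LinearMap.comp_apply, ← h₂] at h₁
    have h₃ : T (Pi.single i 1) = f i := by simp [T]
    rw [← map_smul, smul_eq_mul, mul_one, ← h₃]
    simpa using h₁.symm
  let Φ : CharacterModule (Fin l → E) := ∑ i,
    CharacterModule.dual (LinearMap.proj (R := R) (φ := fun _ : Fin l => E) i) (φ i)
  have hΦ : ∀ v, Φ v = ∑ i, φ i (v i) := fun v =>
    CharacterModule.sum_apply _ _ v
  obtain ⟨Φ', hΦ'⟩ := ((IsSES.ker_subtype κ.surjective_rangeRestrict).dual.exact Φ).1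
    (CharacterModule.ext _ fun v => by
      obtain ⟨e, he⟩ := hker v (by simpa using v.2)
      change Φ v = 0
      rw [hΦ]
      refine Eq.trans ?_ (DFunLike.congr_fun hφ e)
      rw [CharacterModule.sum_apply]
      exact Finset.sum_congr rfl fun i _ => congrArg (φ i) (he i))
  obtain ⟨Ψ, rfl⟩ := CharacterModule.dual_surjective_of_injective _
    (LinearMap.range κ).subtype_injective Φ'
  refine ⟨m, fun i j => k j i,
    fun j => CharacterModule.dual (LinearMap.single R (fun _ : Fin m => E) j) Ψ,
    fun i => CharacterModule.ext _ fun e => ?_, fun j => ?_⟩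
  · have h₁ : Ψ (κ (Pi.single i e)) = Φ (Pi.single i e) := 
      DFunLike.congr_fun hΦ' (Pi.single i e : Fin l → E)
    have h₂ : Φ (Pi.single i e) = φ i e := by
      rw [hΦ, Finset.sum_eq_single i (fun j _ hj => by rw [Pi.single_eq_of_ne hj, map_zero])
        (by simp), Pi.single_eq_same]
    have h₃ : κ (Pi.single i e) = ∑ j, Pi.single j (k j i • e) := by
      rw [Finset.univ_sum_single fun j => k j i • e]
      ext j
      rw [hκ, Finset.sum_eq_single i (fun j _ hj => by rw [Pi.single_eq_of_ne hj, smul_zero])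
        (by simp), Pi.single_eq_same]
    rw [← h₂, ← h₁, h₃, map_sum, CharacterModule.sum_apply]
    rfl
  · rw [← hTk j, hT]
    exact Finset.sum_congr rfl fun i _ => mul_comm _ _

namespace FlatCoresolvable

variable {A B C : Type u} [AddCommGroup A] [AddCommGroup B] [AddCommGroup C]
  [Module R A] [Module R B] [Module R C]

theorem torZero (h : FlatCoresolvable R A) : TorZero R A :=
  let ⟨_, hA, hW⟩ := h
  (hW _ hA).1

theorem exists_isSES (h : FlatCoresolvable R A) :
    ∃ (F A' : ModuleCat.{u} R) (f : A →ₗ[R] F) (g : F →ₗ[R] A'),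
      IsSES f g ∧ Module.Flat R F ∧ FlatCoresolvable R A' :=
  let ⟨W, hA, hW⟩ := h
  let ⟨_, F, A', f, g, hfg, hF, hA'⟩ := hW _ hA
  ⟨F, A', f, g, hfg, hF, W, hA', hW⟩

theorem of_isSES (hA : TorZero R A) {f : A →ₗ[R] B} {g : B →ₗ[R] C} (h : IsSES f g)
    (hB : Module.Flat R B) (hC : FlatCoresolvable R C) : FlatCoresolvable R A := by
  refine ⟨fun X => X = ModuleCat.of R A ∨ FlatCoresolvable R X, .inl rfl, ?_⟩
  rintro X (rfl | hX)
  · exact ⟨hA, ModuleCat.of R B, ModuleCat.of R C, f, g, h, hB, .inr hC⟩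
  · obtain ⟨F, X', f, g, hfg, hF, hX'⟩ := hX.exists_isSES
    exact ⟨hX.torZero, F, X', f, g, hfg, hF, .inr hX'⟩

theorem of_flat (hA : Module.Flat R A) : FlatCoresolvable R A := by
  refine ⟨fun X => Module.Flat R X, hA, fun X hX => ⟨hX.torZero, X, ModuleCat.of R PUnit.{u + 1},
    LinearMap.id, 0, ⟨fun _ _ h => h, fun x => ?_, fun x => ⟨0, rfl⟩⟩, hX, ?_⟩⟩
  · simp
  · change Module.Flat R PUnit.{u + 1}
    infer_instance

/-- The closure of the flat coresolvable modules under extensions. -/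
inductive ExtClosure : ModuleCat.{u} R → Prop
  | of {X : ModuleCat.{u} R} : FlatCoresolvable R X → ExtClosure X
  | ext {X Y Z : ModuleCat.{u} R} (f : X →ₗ[R] Y) (g : Y →ₗ[R] Z) :
      IsSES f g → ExtClosure X → ExtClosure Z → ExtClosure Y

theorem ExtClosure.torZero_and_exists_isSES (hcoh : IsCoherentRing R) {X : ModuleCat.{u} R}
    (hX : ExtClosure X) : TorZero R X ∧
      ∃ (F X' : ModuleCat.{u} R) (f : X →ₗ[R] F) (g : F →ₗ[R] X'),
        IsSES f g ∧ Module.Flat R F ∧ ExtClosure X' := by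
  induction hX with
  | of hX =>
    obtain ⟨F, X', f, g, hfg, hF, hX'⟩ := hX.exists_isSES
    exact ⟨hX.torZero, F, X', f, g, hfg, hF, .of hX'⟩
  | @ext X Y Z f g hfg _ _ ihX ihZ =>
    obtain ⟨hX, F, X', a, p, hap, hF, hX'⟩ := ihX
    obtain ⟨hZ, G, Z', c, q, hcq, hG, hZq⟩ := ihZ
    have hJ := flat_dual_of_injective hcoh hF.dual_injective
    have hev := IsSES.mkQ (CharacterModule.ev_injective (R := R) (A := F))
    have hu := IsSES.mkQ (f := CharacterModule.ev R F ∘ₗ a)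
      (CharacterModule.ev_injective.comp hap.inj)
    obtain ⟨s, t, hst⟩ := hap.third_iso hev hu
    obtain ⟨k, hk⟩ := hfg.extend_dual hZ hF.dual_injective (CharacterModule.ev R F ∘ₗ a)
    have hw : Function.Injective (k.prod (c ∘ₗ g)) := by
      rw [injective_iff_map_eq_zero]
      intro y hy
      have hy₁ : k y = 0 := congrArg Prod.fst hy
      have hy₂ : c (g y) = 0 := congrArg Prod.snd hy
      obtain ⟨x, rfl⟩ := (hfg.exact y).1 (hcq.inj (by rw [hy₂, map_zero]))
      have : CharacterModule.ev R F (a x) = 0 := (LinearMap.congr_fun hk x).symm.trans hy₁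
      have hx : x = 0 := hap.inj (CharacterModule.ev_injective (by rw [this, map_zero, map_zero]))
      rw [hx, map_zero]
    obtain ⟨v, r, hvr⟩ := hfg.horseshoe hu hcq hk (IsSES.mkQ hw)
    refine ⟨hfg.torZero_middle hX hZ, ModuleCat.of R _, ModuleCat.of R _, _, _, IsSES.mkQ hw,
      hJ.prod' hG, ?_⟩
    exact .ext (X := ModuleCat.of R _) (Y := ModuleCat.of R _) v r hvr
      (.ext (Y := ModuleCat.of R _) (Z := ModuleCat.of R _) s t hst hX'
        (.of (of_flat (flat_double_dual_quotient hJ hev)))) hZq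

/-- Over a coherent ring, flat coresolvable modules are closed under extensions. -/
theorem ext (hcoh : IsCoherentRing R) {f : A →ₗ[R] B} {g : B →ₗ[R] C} (h : IsSES f g)
    (hA : FlatCoresolvable R A) (hC : FlatCoresolvable R C) : FlatCoresolvable R B :=
  ⟨ExtClosure, .ext (X := ModuleCat.of R A) (Y := ModuleCat.of R B) (Z := ModuleCat.of R C) f g h
    (.of hA) (.of hC), fun _ hX => hX.torZero_and_exists_isSES hcoh⟩

end FlatCoresolvable

section Complexes

theorem Function.Exact.nonempty_iso_cokernel {X Y : ModuleCat.{u} R} {f : X ⟶ Y}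
    {M : ModuleCat.{u} R} {p : Y →ₗ[R] M} (hp : Function.Exact f.hom p)
    (hs : Function.Surjective p) : Nonempty (M ≅ cokernel f) :=
  ⟨(hp.linearEquivOfSurjective hs).symm.toModuleIso ≪≫
    (ModuleCat.cokernelIsoRangeQuotient f).symm⟩

theorem exists_exact_of_iso_cokernel {X Y : ModuleCat.{u} R} {f : X ⟶ Y}
    {M : ModuleCat.{u} R} (e : M ≅ cokernel f) :
    ∃ p : Y →ₗ[R] M, Function.Exact f.hom p ∧ Function.Surjective p := by
  have e' := (e ≪≫ ModuleCat.cokernelIsoRangeQuotient f).toLinearEquiv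
  refine ⟨e'.symm.toLinearMap ∘ₗ (LinearMap.range f.hom).mkQ, ?_,
    e'.symm.surjective.comp (Submodule.mkQ_surjective _)⟩
  intro y
  simp

theorem ChainComplex.exactAt_succ_iff (C : ChainComplex (ModuleCat.{u} R) ℤ) (i : ℤ) :
    C.ExactAt (i + 1) ↔ Function.Exact (C.d (i + 1 + 1) (i + 1)).hom (C.d (i + 1) i).hom := by
  rw [C.exactAt_iff' (i + 1 + 1) (i + 1) i (ChainComplex.prev ℤ _) (by simp),
    ShortComplex.ShortExact.moduleCat_exact_iff_function_exact]
  rfl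

theorem Function.Exact.splice {A B C D E : Type u} [AddCommGroup A] [AddCommGroup B]
    [AddCommGroup C] [AddCommGroup D] [AddCommGroup E] [Module R A] [Module R B] [Module R C]
    [Module R D] [Module R E] {g₂ : A →ₗ[R] B} {f₁ : B →ₗ[R] C} {g₁ : C →ₗ[R] D} {f₀ : D →ₗ[R] E}
    (h : Function.Exact f₁ g₁) (hg : Function.Surjective g₂) (hf : Function.Injective f₀) :
    Function.Exact (f₁ ∘ₗ g₂) (f₀ ∘ₗ g₁) := by
  rw [LinearMap.exact_iff] at h ⊢
  rw [LinearMap.ker_comp_of_ker_eq_bot _ (LinearMap.ker_eq_bot.2 hf), h,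
    LinearMap.range_comp_of_range_eq_top _ (LinearMap.range_eq_top.2 hg)]

theorem Function.Exact.exists_isSES {A B C X Y : Type u} [AddCommGroup A] [AddCommGroup B]
    [AddCommGroup C] [AddCommGroup X] [AddCommGroup Y] [Module R A] [Module R B] [Module R C]
    [Module R X] [Module R Y] {a : A →ₗ[R] B} {d : B →ₗ[R] C} (had : Function.Exact a d)
    {q : B →ₗ[R] Y} (hq : Function.Exact a q) (hqs : Function.Surjective q)
    {p : C →ₗ[R] X} (hp : Function.Exact d p) (hps : Function.Surjective p) :
    ∃ f : Y →ₗ[R] C, IsSES f p ∧ f ∘ₗ q = d := by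
  obtain ⟨f, hf⟩ := (IsSES.ker_subtype hqs).desc d (by
    rw [← LinearMap.range_le_ker_iff, Submodule.range_subtype, hq.linearMap_ker_eq,
      had.linearMap_ker_eq])
  refine ⟨f, ⟨?_, ?_, hps⟩, hf⟩
  · rw [injective_iff_map_eq_zero]
    intro y hy
    obtain ⟨b, rfl⟩ := hqs y
    exact (hq b).2 ((had b).1 ((LinearMap.congr_fun hf b).symm.trans hy))
  · rw [LinearMap.exact_iff, hp.linearMap_ker_eq, ← hf, LinearMap.range_comp_of_range_eq_top _
      (LinearMap.range_eq_top.2 hqs)]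

/-- `X` is a cosyzygy of the complex `C` in degree `i`. -/
def IsCosyzygy (C : ChainComplex (ModuleCat.{u} R) ℤ) (i : ℤ) (X : ModuleCat.{u} R) : Prop :=
  ∃ p : C.X i →ₗ[R] X, Function.Exact (C.d (i + 1) i).hom p ∧ Function.Surjective p

theorem IsCosyzygy.exists_isSES {C : ChainComplex (ModuleCat.{u} R) ℤ} (hC : ∀ i, C.ExactAt i)
    {i : ℤ} {X : ModuleCat.{u} R} (hX : IsCosyzygy C (i + 1) X) :
    ∃ (X' : ModuleCat.{u} R) (f : X →ₗ[R] C.X i) (g : C.X i →ₗ[R] X'),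
      IsSES f g ∧ IsCosyzygy C i X' := by
  obtain ⟨q, hq, hqs⟩ := hX
  have hp := LinearMap.exact_map_mkQ_range (C.d (i + 1) i).hom
  obtain ⟨f, hf, -⟩ := ((C.exactAt_succ_iff i).1 (hC _)).exists_isSES hq hqs hp
    (Submodule.mkQ_surjective _)
  exact ⟨ModuleCat.of R _, f, _, hf, _, hp, Submodule.mkQ_surjective _⟩

theorem IsCosyzygy.torZero {C : ChainComplex (ModuleCat.{u} R) ℤ}
    (hF : ∀ i, Module.Flat R (C.X i)) (hC : ∀ i, C.ExactAt i)
    (hT : ∀ I : ModuleCat.{u} R, Injective I → ∀ i : ℤ,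
      (((tensorLeft I).mapHomologicalComplex (ComplexShape.down ℤ)).obj C).ExactAt i)
    {i : ℤ} {X : ModuleCat.{u} R} (hX : IsCosyzygy C i X) : TorZero R X := by
  intro I _ _ hI n
  induction n generalizing i X with
  | zero =>
    obtain ⟨p, hp, hps⟩ := hX
    have hq := LinearMap.exact_map_mkQ_range (C.d (i + 1 + 1) (i + 1)).hom
    obtain ⟨f, hf, hfq⟩ := ((C.exactAt_succ_iff i).1 (hC _)).exists_isSES hq
      (Submodule.mkQ_surjective _) hp hps
    refine hf.dual.extZero_one_of_lift ((hF i).torZero I hI 0)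
      (lift_of_lTensor_injective ?_)
    rw [injective_iff_map_eq_zero]
    intro z hz
    obtain ⟨w, rfl⟩ := LinearMap.lTensor_surjective I (Submodule.mkQ_surjective _) z
    have hI' := (ChainComplex.exactAt_succ_iff _ i).1
      (hT (ModuleCat.of R I) ((Module.injective_iff_injective_object R I).1 hI) (i + 1))
    rw [← LinearMap.comp_apply, ← LinearMap.lTensor_comp, hfq] at hz
    obtain ⟨v, hv⟩ := (hI' w).1 hz
    exact (lTensor_exact I hq (Submodule.mkQ_surjective _) w).2 ⟨v, hv⟩
  | succ n ih =>
    obtain ⟨p, hp, hps⟩ := hX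
    have hq := LinearMap.exact_map_mkQ_range (C.d (i + 1 + 1) (i + 1)).hom
    obtain ⟨f, hf, -⟩ := ((C.exactAt_succ_iff i).1 (hC _)).exists_isSES hq
      (Submodule.mkQ_surjective _) hp hps
    exact hf.dual.extZero_left (ih (X := ModuleCat.of R _) ⟨_, hq, Submodule.mkQ_surjective _⟩)
      ((hF i).torZero I hI _)

theorem IsGorensteinFlat.flatCoresolvable {M : ModuleCat.{u} R} (hM : IsGorensteinFlat M) :
    FlatCoresolvable R M := by
  obtain ⟨C, hF, hC, ⟨e⟩, hT⟩ := hM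
  obtain ⟨p, hp, hps⟩ := exists_exact_of_iso_cokernel e
  refine ⟨fun X => ∃ i, IsCosyzygy C i X, ⟨0, p, hp, hps⟩, ?_⟩
  rintro X ⟨i, hX⟩
  refine ⟨hX.torZero hF hC hT, ?_⟩
  obtain ⟨i, rfl⟩ : ∃ j, i = j + 1 := ⟨i - 1, by ring⟩
  obtain ⟨X', f, g, hfg, hX'⟩ := hX.exists_isSES hC
  exact ⟨_, X', f, g, hfg, hF i, i, hX'⟩

end Complexes

section Splicing

/-- `X` is a first syzygy of `Y` with respect to a flat module. -/
def IsFlatSyzygy (X Y : ModuleCat.{u} R) : Prop :=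
  ∃ (F : ModuleCat.{u} R) (f : X →ₗ[R] F) (g : F →ₗ[R] Y), IsSES f g ∧ Module.Flat R F

theorem exists_isFlatSyzygy {Y : ModuleCat.{u} R} (hY : TorZero R Y) :
    ∃ X : ModuleCat.{u} R, IsFlatSyzygy X Y ∧ TorZero R X := by
  have hs : Function.Surjective (Finsupp.linearCombination R (id : Y → Y)) :=
    Finsupp.linearCombination_id_surjective R Y
  have hF : Module.Flat R (Y →₀ R) := inferInstance
  have h := IsSES.ker_subtype hs
  exact ⟨ModuleCat.of R _, ⟨ModuleCat.of R _, _, _, h, hF⟩, h.torZero_left hF.torZero hY⟩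

theorem exists_seq_of_forall_exists {α : Type*} {P : α → Prop} {r : α → α → Prop}
    (h : ∀ x, P x → ∃ y, r x y ∧ P y) {a : α} (ha : P a) :
    ∃ s : ℕ → α, s 0 = a ∧ (∀ n, P (s n)) ∧ ∀ n, r (s n) (s (n + 1)) := by
  choose! F hF using h
  have hP : ∀ n, P (Nat.rec a (fun _ x => F x) n) := fun n => by
    induction n with
    | zero => exact ha
    | succ n ih => exact (hF _ ih).2
  exact ⟨fun n => Nat.rec a (fun _ x => F x) n, rfl, hP, fun n => (hF _ (hP n)).1⟩

theorem FlatCoresolvable.exists_int_seq {M : ModuleCat.{u} R} (hM : FlatCoresolvable R M) :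
    ∃ Z : ℤ → ModuleCat.{u} R, Z 0 = M ∧ (∀ i, TorZero R (Z i)) ∧
      ∀ i, IsFlatSyzygy (Z (i + 1)) (Z i) := by
  obtain ⟨s, hs₀, hs, hs'⟩ := exists_seq_of_forall_exists (α := ModuleCat.{u} R)
    (P := fun X => TorZero R X) (r := fun Y X => IsFlatSyzygy X Y)
    (fun _ => exists_isFlatSyzygy) hM.torZero
  obtain ⟨t, ht₀, ht, ht'⟩ := exists_seq_of_forall_exists (α := ModuleCat.{u} R)
    (P := fun X => FlatCoresolvable R X) (r := fun X Y => IsFlatSyzygy X Y)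
    (fun X hX => by
      obtain ⟨F, X', f, g, hfg, hF, hX'⟩ := hX.exists_isSES
      exact ⟨X', ⟨F, f, g, hfg, hF⟩, hX'⟩) hM
  refine ⟨fun i => Int.rec s (fun n => t (n + 1)) i, hs₀, ?_, ?_⟩
  · rintro (n | n)
    · exact hs n
    · exact (ht _).torZero
  · rintro (n | _ | n)
    · exact hs' n
    · have := ht' 0
      rw [ht₀, ← hs₀] at this
      exact this
    · exact ht' (n + 1)

theorem FlatCoresolvable.isGorensteinFlat {M : ModuleCat.{u} R} (hM : FlatCoresolvable R M) :
    IsGorensteinFlat M := by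
  obtain ⟨Z, rfl, hZ, hr⟩ := hM.exists_int_seq
  choose F f g hfg hF using hr
  let d (i : ℤ) : F (i + 1) ⟶ F i := ModuleCat.ofHom (f i ∘ₗ g (i + 1))
  let C : ChainComplex (ModuleCat.{u} R) ℤ :=
    ChainComplex.of F d fun i => by
      ext x
      exact (congrArg (f i) (LinearMap.congr_fun (hfg (i + 1)).comp_eq_zero
        (g (i + 1 + 1) x))).trans (map_zero _)
  have hd : ∀ i, (C.d (i + 1) i).hom = f i ∘ₗ g (i + 1) := fun i =>
    congrArg ModuleCat.Hom.hom (ChainComplex.of_d F d i)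
  refine ⟨C, hF, fun i => ?_, ?_, fun I hI i => ?_⟩
  · obtain ⟨i, rfl⟩ : ∃ j, i = j + 1 := ⟨i - 1, by ring⟩
    rw [ChainComplex.exactAt_succ_iff, hd, hd]
    exact (hfg (i + 1)).exact.splice (hfg _).surj (hfg i).inj
  · refine Function.Exact.nonempty_iso_cokernel (p := g 0) ?_ (hfg 0).surj
    have : (C.d 1 0).hom = f 0 ∘ₗ g 1 := hd 0
    rw [this, LinearMap.exact_iff, (hfg 0).exact.linearMap_ker_eq,
      LinearMap.range_comp_of_range_eq_top _ (LinearMap.range_eq_top.2 (hfg 1).surj)]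
  · obtain ⟨i, rfl⟩ : ∃ j, i = j + 1 := ⟨i - 1, by ring⟩
    rw [ChainComplex.exactAt_succ_iff]
    change Function.Exact ((C.d (i + 1 + 1) (i + 1)).hom.lTensor I) ((C.d (i + 1) i).hom.lTensor I)
    rw [hd, hd, LinearMap.lTensor_comp, LinearMap.lTensor_comp]
    exact (lTensor_exact I (hfg (i + 1)).exact (hfg (i + 1)).surj).splice
      (LinearMap.lTensor_surjective I (hfg _).surj)
      ((hfg i).lTensor_injective (hZ i) ((Module.injective_iff_injective_object R I).2 hI))

end Splicing

section Structure

variable {A B C X Y Z : Type u} [AddCommGroup A] [AddCommGroup B] [AddCommGroup C]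
  [AddCommGroup X] [AddCommGroup Y] [AddCommGroup Z]
  [Module R A] [Module R B] [Module R C] [Module R X] [Module R Y] [Module R Z]

theorem IsSES.comp_equiv {f : A →ₗ[R] B} {g : B →ₗ[R] C} (h : IsSES f g) (e : C ≃ₗ[R] Z) :
    IsSES f (e.toLinearMap ∘ₗ g) :=
  ⟨h.inj, fun b => by simpa using h.exact b, e.surjective.comp h.surj⟩

theorem IsSES.prod_swap {i : A →ₗ[R] B} {j : A →ₗ[R] X} {w : B × X →ₗ[R] Z}
    (hw : IsSES (i.prod (-j)) w) :
    IsSES (j.prod (-i)) (w ∘ₗ (LinearEquiv.prodComm R X B).toLinearMap) := by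
  refine ⟨?_, ?_, hw.surj.comp (LinearEquiv.prodComm R X B).surjective⟩
  · intro a a' h
    have h₁ : j a = j a' := congrArg Prod.fst h
    have h₂ : -i a = -i a' := congrArg Prod.snd h
    exact hw.inj (Prod.ext (neg_injective h₂) (congrArg Neg.neg h₁))
  · rintro ⟨x, b⟩
    refine (hw.exact (b, x)).trans ⟨?_, ?_⟩
    · rintro ⟨a, ha⟩
      have h₁ : i a = b := congrArg Prod.fst ha
      have h₂ : -j a = x := congrArg Prod.snd ha
      exact ⟨-a, Prod.ext (by simp [← h₂]) (by simp [← h₁])⟩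
    · rintro ⟨a, ha⟩
      have h₁ : j a = x := congrArg Prod.fst ha
      have h₂ : -i a = b := congrArg Prod.snd ha
      exact ⟨-a, Prod.ext (by simp [← h₂]) (by simp [← h₁])⟩

theorem IsSES.hasInjectiveDimensionLT_left {f : A →ₗ[R] B} {g : B →ₗ[R] C} (h : IsSES f g)
    (hB : Module.Injective R B) {n : ℕ} (hC : HasInjectiveDimensionLT (ModuleCat.of R C) n) :
    HasInjectiveDimensionLT (ModuleCat.of R A) (n + 1) := by
  have : Injective (ModuleCat.of R B) := (Module.injective_iff_injective_object R B).1 hB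
  exact h.shortExact.hasInjectiveDimensionLT_X₁ n hC
    (hasInjectiveDimensionLT_of_ge (ModuleCat.of R B) 1 _ (by omega))

theorem GfdLE.exists_isSES (hcoh : IsCoherentRing R) {n : ℕ} {M : ModuleCat.{u} R}
    (hM : GfdLE n M) : ∃ (K G : ModuleCat.{u} R) (k : K →ₗ[R] G) (g : G →ₗ[R] M),
      IsSES k g ∧ FlatCoresolvable R G ∧
        HasInjectiveDimensionLT (ModuleCat.of R (CharacterModule K)) n := by
  induction n generalizing M with
  | zero =>
    refine ⟨ModuleCat.of R PUnit.{u + 1}, M, 0, LinearMap.id,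
      ⟨fun _ _ _ => rfl, fun x => ?_, fun x => ⟨x, rfl⟩⟩,
      IsGorensteinFlat.flatCoresolvable hM, ?_⟩
    · simpa using eq_comm
    · have : Subsingleton (CharacterModule PUnit.{u + 1}) :=
        ⟨fun a b => CharacterModule.ext _ fun x => by
          rw [Subsingleton.elim x 0, map_zero, map_zero]⟩
      exact (ModuleCat.isZero_of_subsingleton _).hasInjectiveDimensionLT_zero
  | succ n ih =>
    obtain ⟨S, hS, ⟨e⟩, hG, hK⟩ := hM
    obtain ⟨K, G, k, g, hkg, hG', hKn⟩ := ih hK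
    obtain ⟨F, G', ι, π, hιπ, hF, hG''⟩ := hG'.exists_isSES
    have hL := IsSES.mkQ (f := ι ∘ₗ k) (hιπ.inj.comp hkg.inj)
    obtain ⟨a, b, hab⟩ := hkg.third_iso hιπ hL
    have hSES := IsSES.of_shortExact hS
    have hw := IsSES.mkQ (f := S.f.hom.prod (-a)) (fun x y h => hSES.inj (congrArg Prod.fst h))
    obtain ⟨c, hc⟩ := hSES.pushout hab hw
    obtain ⟨d, hd⟩ := hab.pushout hSES hw.prod_swap
    exact ⟨ModuleCat.of R _, ModuleCat.of R _, _, _, hd.comp_equiv e.toLinearEquiv,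
      FlatCoresolvable.ext hcoh hc hG.flatCoresolvable hG'',
      hL.dual.hasInjectiveDimensionLT_left hF.dual_injective hKn⟩

end Structure

section Main

theorem exists_isSES_injective (L : Type u) [AddCommGroup L] [Module R L] :
    ∃ (E L' : ModuleCat.{u} R) (f : L →ₗ[R] E) (g : E →ₗ[R] L'),
      IsSES f g ∧ Module.Injective R E := by
  have hf := (ModuleCat.mono_iff_injective (Injective.ι (ModuleCat.of R L))).1 inferInstance
  exact ⟨_, ModuleCat.of R _, _, _, IsSES.mkQ hf,
    (Module.injective_iff_injective_object R _).2
      (inferInstanceAs (Injective (Injective.under (ModuleCat.of R L))))⟩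

/-- Modules of finite injective dimension are acyclic for tensoring with a module that is acyclic
for tensoring with injective modules. -/
theorem TorZero.extZero_of_hasInjectiveDimensionLT {G : Type u} [AddCommGroup G] [Module R G]
    (hG : TorZero R G) {m : ℕ} {L : Type u} [AddCommGroup L] [Module R L]
    (hL : HasInjectiveDimensionLT (ModuleCat.of R L) (m + 1)) (n : ℕ) :
    ExtZero R L (CharacterModule G) (n + 1) := by
  induction m generalizing L n with
  | zero =>
    rw [zero_add] at hL
    exact hG L ((Module.injective_iff_injective_object R L).2 inferInstance) n
  | succ m ih =>
    obtain ⟨E, L', f, g, hfg, hE⟩ := exists_isSES_injective (R := R) L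
    have hE' : Injective (ModuleCat.of R E) := (Module.injective_iff_injective_object R E).1 hE
    have hL' : HasInjectiveDimensionLT (ModuleCat.of R L') (m + 1) :=
      hfg.shortExact.hasInjectiveDimensionLT_X₃ (m + 1)
        (hasInjectiveDimensionLT_of_ge (ModuleCat.of R E) 1 _ (by omega)) hL
    exact hfg.extZero_contra_left (hG E hE n) (ih hL' (n + 1))

theorem IsCosyzygy.extZero {C : ChainComplex (ModuleCat.{u} R) ℤ} (hP : ∀ i, Projective (C.X i))
    (hC : ∀ i, C.ExactAt i) {L : Type u} [AddCommGroup L] [Module R L] {m : ℕ}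
    (hL : HasInjectiveDimensionLT (ModuleCat.of R L) m) {i : ℤ} {X : ModuleCat.{u} R}
    (hX : IsCosyzygy C i X) (n : ℕ) : ExtZero R X L (n + 1) := by
  obtain ⟨k, hk⟩ : ∃ k, m ≤ n + 1 + k := ⟨m, by omega⟩
  induction k generalizing i X n with
  | zero => exact HasInjectiveDimensionLT.subsingleton _ m _ (by omega) _
  | succ k ih =>
    obtain ⟨i, rfl⟩ : ∃ j, i = j + 1 := ⟨i - 1, by ring⟩
    obtain ⟨X', f, g, hfg, hX'⟩ := hX.exists_isSES hC
    exact hfg.extZero_contra_left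
      (extZero_of_projective ((IsProjective.iff_projective _).2 (hP i)) n)
      (ih hX' (n + 1) (by omega))

theorem IsGorensteinProjective.exists_isSES {Q : ModuleCat.{u} R} (hQ : IsGorensteinProjective Q)
    {L : Type u} [AddCommGroup L] [Module R L] {m : ℕ}
    (hL : HasInjectiveDimensionLT (ModuleCat.of R L) m) :
    ∃ (P Q' : ModuleCat.{u} R) (f : Q →ₗ[R] P) (g : P →ₗ[R] Q'),
      IsSES f g ∧ Module.Projective R P ∧ ExtZero R Q' L 1 := by
  obtain ⟨C, hP, hC, ⟨e⟩, -⟩ := hQ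
  have hX : IsCosyzygy C (-1 + 1) Q := exists_exact_of_iso_cokernel e
  obtain ⟨Q', f, g, hfg, hQ'⟩ := hX.exists_isSES hC
  exact ⟨_, Q', f, g, hfg, (IsProjective.iff_projective _).2 (hP _), hQ'.extZero hP hC hL 0⟩

theorem IsSES.gpPureExact {A B C : Type u} [AddCommGroup A] [AddCommGroup B] [AddCommGroup C]
    [Module R A] [Module R B] [Module R C] {f : A →ₗ[R] B} {g : B →ₗ[R] C} (h : IsSES f g) {m : ℕ}
    (hC : HasInjectiveDimensionLT (ModuleCat.of R C) m) :
    GPPureExact (ModuleCat.shortComplexOfCompEqZero f g h.comp_eq_zero) := by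
  intro Q hQ φ
  obtain ⟨P, Q', a, b, hab, hP, hQ'⟩ := hQ.exists_isSES hC
  obtain ⟨l, hl⟩ := hab.extend hQ' φ.hom
  obtain ⟨t, ht⟩ := Module.projective_lifting_property g l h.surj
  refine ⟨ModuleCat.ofHom (t ∘ₗ a), ModuleCat.hom_ext ?_⟩
  change g ∘ₗ t ∘ₗ a = φ.hom
  rw [← LinearMap.comp_assoc, ht, hl]

theorem GPPureFlat.lTensor_injective {M : ModuleCat.{u} R} (hM : GPPureFlat M)
    {A B C : Type u} [AddCommGroup A] [AddCommGroup B] [AddCommGroup C]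
    [Module R A] [Module R B] [Module R C] {f : A →ₗ[R] B} {g : B →ₗ[R] C} (h : IsSES f g) {m : ℕ}
    (hC : HasInjectiveDimensionLT (ModuleCat.of R C) m) : Function.Injective (f.lTensor M) := by
  have key := hM _ h.shortExact (h.gpPureExact hC)
  have e : (tensorLeft M).map (ModuleCat.shortComplexOfCompEqZero f g h.comp_eq_zero).f =
      ModuleCat.ofHom (f.lTensor M) :=
    ModuleCat.hom_ext (ModuleCat.hom_whiskerLeft M (ModuleCat.ofHom f))
  rw [e] at key
  exact key

theorem GPPureFlat.flatCoresolvable (hcoh : IsCoherentRing R) {M : ModuleCat.{u} R}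
    (hM : GPPureFlat M) {n : ℕ} (hn : GfdLE n M) : FlatCoresolvable R M := by
  obtain ⟨K, G, k, g, hkg, hG, hK⟩ := hn.exists_isSES hcoh
  obtain ⟨r, hr⟩ := lTensor_injective_iff.1 (hM.lTensor_injective hkg.dual hK) LinearMap.id
  obtain ⟨s, hs⟩ := hkg.dual.section_of_retraction hr
  obtain ⟨F, G', ι, π, hιπ, hF, hG'⟩ := hG.exists_isSES
  have hL := IsSES.mkQ (f := ι ∘ₗ k) (hιπ.inj.comp hkg.inj)
  obtain ⟨a, b, hab⟩ := hkg.third_iso hιπ hL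
  obtain ⟨t, ht⟩ := hιπ.dual.lift (hG'.torZero.extZero_of_hasInjectiveDimensionLT
    (hasInjectiveDimensionLT_of_ge (ModuleCat.of R (CharacterModule K)) n (n + 1) (by omega)) 0) s
  obtain ⟨q, hq⟩ := hL.dual.retraction_of_section (s := t) (by
    rw [← hs, ← ht]; rfl)
  have hflat := Module.Flat.of_dual_injective (hF.dual_injective.of_retract hq)
  exact FlatCoresolvable.of_isSES (fun I _ _ hI n => (hG.torZero I hI n).of_retract hr) hab
    hflat hG'

end Main

/-- Over a coherent ring, a `GP`-pure flat module of finite Gorenstein flat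
dimension is Gorenstein flat. -/
theorem stmt9 {R : Type u} [CommRing R] (hcoh : IsCoherentRing R) (M : ModuleCat.{u} R)
    (hM : GPPureFlat M) (hfin : ∃ n : ℕ, GfdLE n M) :
    IsGorensteinFlat M := by
  obtain ⟨n, hn⟩ := hfin
  exact (GPPureFlat.flatCoresolvable hcoh hM hn).isGorensteinFlat
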